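/- Let d ≥ 1, let A and B be nonsingular real d×d matrices, and let Ω_A, Ω_B ⊂ ℝ^d be bounded sets, each containing 0 in its interior, such that the translates {Ω_A + Ak : k ∈ ℤ^d} are pairwise disjoint and cover ℝ^d pointwise (i.e. Σ_{k∈ℤ^d} χ_{Ω_A}(x+Ak) = 1 for every x ∈ ℝ^d), and likewise for {Ω_B + Bk : k ∈ ℤ^d}. Assume that the matrix N = Bᵀ A has all integer entries. Then the set Λ_N = {k ∈ ℤ^d : B^{−T}k ∈ Ω_A} is finite, and for every k ∈ ℤ^d, (1/|det N|) · Σ_{j ∈ Λ_N} exp(2πi kᵀ N^{−1} j) equals 1 if k ∈ Nᵀℤ^d, and equals 0 otherwise. -/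

import Mathlib

open Matrix MeasureTheory
open scoped Classical

noncomputable section

/-- The integer vector `k` viewed as a real vector. -/
def intVec {d : ℕ} (k : Fin d → ℤ) : Fin d → ℝ := fun i => (k i : ℝ)

/-- The set `Λ_M(Ω) = {k ∈ ℤ^d : M^{-T} k ∈ Ω}`. -/
def LamSet {d : ℕ} (M : Matrix (Fin d) (Fin d) ℝ) (Ω : Set (Fin d → ℝ)) :
    Set (Fin d → ℤ) :=
  {k | (Mᵀ)⁻¹.mulVec (intVec k) ∈ Ω}

theorem card_quotient_range_mulVecLin {ι : Type*} [Fintype ι] [DecidableEq ι]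
    (N : Matrix ι ι ℤ) (hN : N.det ≠ 0) :
    Nat.card ((ι → ℤ) ⧸ LinearMap.range N.mulVecLin) = N.det.natAbs := by
  have hinj : Function.Injective N.mulVecLin := Matrix.mulVec_injective_of_det_ne_zero hN
  rw [← Submodule.natAbs_det_equiv _ (LinearEquiv.ofInjective N.mulVecLin hinj)]
  have : (LinearMap.range N.mulVecLin).subtype ∘ₗ AddMonoidHom.toIntLinearMap
      (LinearEquiv.ofInjective N.mulVecLin hinj : (ι → ℤ) →+ LinearMap.range N.mulVecLin) =
      Matrix.toLin' N := by
    ext1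
    rfl
  rw [this, LinearMap.det_toLin']

theorem finsum_mem_addChar_of_bijOn_mk {M : Type*} [AddCommGroup M] (H : Submodule ℤ M)
    [Finite (M ⧸ H)] {Λ : Set M} (hΛ : Set.BijOn (Submodule.Quotient.mk (p := H)) Λ Set.univ)
    (χ : AddChar M ℂ) (hχ : ∀ h ∈ H, χ h = 1) :
    ∑ᶠ j ∈ Λ, χ j = if χ = 1 then (Nat.card (M ⧸ H) : ℂ) else 0 := by
  have := Fintype.ofFinite (M ⧸ H)
  have hker : H.toAddSubgroup ≤ χ.toAddMonoidHom.ker := fun h hh => hχ h hh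
  let ψ : AddChar (M ⧸ H) ℂ := AddChar.toAddMonoidHomEquiv.symm
    (QuotientAddGroup.lift H.toAddSubgroup χ.toAddMonoidHom hker)
  have hψ : ∀ j : M, χ j = ψ (Submodule.Quotient.mk j) := fun _ => rfl
  have hiff : ψ = 0 ↔ χ = 1 := by
    constructor
    · intro h
      ext j
      simp [hψ, h]
    · intro h
      ext q
      obtain ⟨j, rfl⟩ := Submodule.Quotient.mk_surjective _ q
      simp [← hψ, h]
  rw [finsum_mem_eq_of_bijOn _ hΛ (fun j _ => hψ j), finsum_mem_univ, finsum_eq_sum_of_fintype,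
    AddChar.sum_eq_ite, Nat.card_eq_fintype_card]
  simp only [hiff]

theorem intVec_add {d : ℕ} (j l : Fin d → ℤ) : intVec (j + l) = intVec j + intVec l := by
  ext i
  simp [intVec]

theorem intVec_mulVec {d : ℕ} (N : Matrix (Fin d) (Fin d) ℤ) (j : Fin d → ℤ) :
    intVec (N.mulVec j) = (N.map ((↑) : ℤ → ℝ)).mulVec (intVec j) := by
  ext i
  simp [intVec, Matrix.mulVec, dotProduct]

theorem intVec_injective {d : ℕ} : Function.Injective (intVec (d := d)) := fun j l h => by
  ext i
  exact Int.cast_injective (congrFun h i)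

theorem intVec_dotProduct {d : ℕ} (j l : Fin d → ℤ) :
    intVec j ⬝ᵥ intVec l = ((j ⬝ᵥ l : ℤ) : ℝ) := by
  simp [intVec, dotProduct]

/-- The character `j ↦ exp (2πi v ⬝ j)` of `ℤ^d`. -/
def expChar {d : ℕ} (v : Fin d → ℝ) : AddChar (Fin d → ℤ) ℂ where
  toFun j := Complex.exp (2 * (Real.pi : ℂ) * Complex.I * ((v ⬝ᵥ intVec j : ℝ) : ℂ))
  map_zero_eq_one' := by simp [intVec, dotProduct]
  map_add_eq_mul' j l := by
    rw [← Complex.exp_add, intVec_add, dotProduct_add]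
    push_cast
    ring_nf

theorem expChar_apply_eq_one_iff {d : ℕ} (v : Fin d → ℝ) (j : Fin d → ℤ) :
    expChar v j = 1 ↔ ∃ n : ℤ, v ⬝ᵥ intVec j = n := by
  change Complex.exp _ = 1 ↔ _
  rw [Complex.exp_eq_one_iff]
  refine exists_congr fun n => ?_
  rw [mul_comm, mul_left_inj' Complex.two_pi_I_ne_zero]
  norm_cast

theorem expChar_eq_one_iff {d : ℕ} (v : Fin d → ℝ) :
    expChar v = 1 ↔ ∃ m : Fin d → ℤ, v = intVec m := by
  constructor
  · intro h
    have hv : ∀ i, ∃ n : ℤ, v i = n := fun i => by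
      obtain ⟨n, hn⟩ := (expChar_apply_eq_one_iff v (Pi.single i 1)).1 (by simp [h])
      have hs : intVec (Pi.single i 1 : Fin d → ℤ) = Pi.single i 1 := by
        ext l
        by_cases hl : l = i <;> simp [intVec, hl]
      exact ⟨n, by simpa [hs] using hn⟩
    choose m hm using hv
    exact ⟨m, funext hm⟩
  · rintro ⟨m, rfl⟩
    ext j
    exact (expChar_apply_eq_one_iff _ j).2 ⟨_, intVec_dotProduct m j⟩

theorem bijOn_mk_LamSet {d : ℕ} {A B : Matrix (Fin d) (Fin d) ℝ} (hB : B.det ≠ 0)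
    {Ω : Set (Fin d → ℝ)}
    (htile : ∀ x : Fin d → ℝ, ∃! k : Fin d → ℤ, x + A.mulVec (intVec k) ∈ Ω)
    {N : Matrix (Fin d) (Fin d) ℤ} (hN : N.map ((↑) : ℤ → ℝ) = Bᵀ * A) :
    Set.BijOn (Submodule.Quotient.mk (p := LinearMap.range N.mulVecLin)) (LamSet B Ω)
      Set.univ := by
  have hB' : IsUnit (Bᵀ).det := by simpa [Matrix.det_transpose] using hB
  have hmem : ∀ j m : Fin d → ℤ, j + N.mulVec m ∈ LamSet B Ω ↔
      (Bᵀ)⁻¹.mulVec (intVec j) + A.mulVec (intVec m) ∈ Ω := fun j m => by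
    rw [LamSet, Set.mem_ofPred_eq, intVec_add, intVec_mulVec, hN, Matrix.mulVec_add,
      Matrix.mulVec_mulVec, Matrix.nonsing_inv_mul_cancel_left _ _ hB']
  refine ⟨fun _ _ => Set.mem_univ _, fun j hj l hl h => ?_, fun q _ => ?_⟩
  · obtain ⟨m, hm⟩ := (Submodule.Quotient.eq _).1 h.symm
    have hjm : l = j + N.mulVec m := by
      rw [← Matrix.mulVecLin_apply, hm]
      abel
    have h0 : j + N.mulVec 0 ∈ LamSet B Ω := by simpa using hj
    have := (htile _).unique ((hmem j m).1 (hjm ▸ hl)) ((hmem j 0).1 h0)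
    simp [hjm, this]
  · obtain ⟨j, rfl⟩ := Submodule.Quotient.mk_surjective _ q
    obtain ⟨m, hm, -⟩ := htile ((Bᵀ)⁻¹.mulVec (intVec j))
    refine ⟨j + N.mulVec m, (hmem j m).2 hm, (Submodule.Quotient.eq _).2 ⟨m, ?_⟩⟩
    simp

theorem stmt_0 (d : ℕ) (hd : 1 ≤ d)
    (A B : Matrix (Fin d) (Fin d) ℝ) (hA : A.det ≠ 0) (hB : B.det ≠ 0)
    (ΩA ΩB : Set (Fin d → ℝ))
    (hΩAbd : Bornology.IsBounded ΩA) (hΩBbd : Bornology.IsBounded ΩB)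
    (hΩA0 : (0 : Fin d → ℝ) ∈ interior ΩA)
    (hΩB0 : (0 : Fin d → ℝ) ∈ interior ΩB)
    (htileA : ∀ x : Fin d → ℝ, ∃! k : Fin d → ℤ, x + A.mulVec (intVec k) ∈ ΩA)
    (htileB : ∀ x : Fin d → ℝ, ∃! k : Fin d → ℤ, x + B.mulVec (intVec k) ∈ ΩB)
    (N : Matrix (Fin d) (Fin d) ℤ)
    (hN : N.map ((↑) : ℤ → ℝ) = Bᵀ * A) :
    (LamSet B ΩA).Finite ∧
    ∀ k : Fin d → ℤ,
      ((|(N.det : ℝ)|⁻¹ : ℝ) : ℂ) *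
        ∑ᶠ j ∈ LamSet B ΩA,
          Complex.exp (2 * (Real.pi : ℂ) * Complex.I *
            ((intVec k ⬝ᵥ (Bᵀ * A)⁻¹.mulVec (intVec j) : ℝ) : ℂ)) =
      (if ∃ m : Fin d → ℤ, k = Nᵀ.mulVec m then 1 else 0) := by
  have hdet : (N.det : ℝ) = (Bᵀ * A).det := by
    rw [← hN]
    exact Int.cast_det N
  have hunit : IsUnit (Bᵀ * A).det := by simp [hA, hB]
  have hN0 : N.det ≠ 0 := by
    have := hunit.ne_zero
    rwa [← hdet, Int.cast_ne_zero] at this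
  have hcard := card_quotient_range_mulVecLin N hN0
  have hbij := bijOn_mk_LamSet hB htileA hN
  have hfin : Finite ((Fin d → ℤ) ⧸ LinearMap.range N.mulVecLin) :=
    Nat.finite_of_card_ne_zero (by simpa [hcard] using hN0)
  refine ⟨hbij.finite_iff_finite.2 Set.finite_univ, fun k => ?_⟩
  let v : Fin d → ℝ := (intVec k) ᵥ* (Bᵀ * A)⁻¹
  have hvk : v ᵥ* (Bᵀ * A) = intVec k := by
    rw [Matrix.vecMul_vecMul, Matrix.nonsing_inv_mul _ hunit, Matrix.vecMul_one]
  have hv : ∀ j ∈ LinearMap.range N.mulVecLin, expChar v j = 1 := by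
    rintro _ ⟨m, rfl⟩
    refine (expChar_apply_eq_one_iff _ _).2 ⟨k ⬝ᵥ m, ?_⟩
    rw [Matrix.mulVecLin_apply, intVec_mulVec, hN, Matrix.dotProduct_mulVec, hvk,
      intVec_dotProduct]
  have hiff : expChar v = 1 ↔ ∃ m : Fin d → ℤ, k = Nᵀ.mulVec m := by
    rw [expChar_eq_one_iff]
    refine exists_congr fun m => ?_
    have hm : intVec (Nᵀ.mulVec m) = intVec m ᵥ* (Bᵀ * A) := by
      rw [intVec_mulVec, Matrix.transpose_map, hN, Matrix.mulVec_transpose]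
    rw [← intVec_injective.eq_iff, hm, ← hvk]
    refine ⟨fun h => h ▸ rfl, fun h => ?_⟩
    simpa [Matrix.vecMul_vecMul, Matrix.mul_nonsing_inv _ hunit] using
      congrArg (· ᵥ* (Bᵀ * A)⁻¹) h
  have hsum := finsum_mem_addChar_of_bijOn_mk _ hbij (expChar v) hv
  have hterm : ∀ j, expChar v j = Complex.exp (2 * (Real.pi : ℂ) * Complex.I *
      ((intVec k ⬝ᵥ (Bᵀ * A)⁻¹.mulVec (intVec j) : ℝ) : ℂ)) := fun j => by
    rw [Matrix.dotProduct_mulVec]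
    rfl
  simp only [hterm, hiff, hcard] at hsum
  rw [hsum, mul_ite, mul_zero]
  congr 1
  have habs : (N.det.natAbs : ℂ) = ((|(N.det : ℝ)| : ℝ) : ℂ) := by
    rw [Nat.cast_natAbs, ← Int.cast_abs, Complex.ofReal_intCast]
  rw [habs, ← Complex.ofReal_mul, inv_mul_cancel₀ (by simpa using hN0), Complex.ofReal_one]
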